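/- arXiv:1812.01382 — 3 statements merged into one kernel-verified Lean document; each statement's English description precedes it below -/
import Mathlib

section
/- For every real ε* > 0 there exists N ∈ ℕ such that for all natural numbers n ≥ N, Breaker has a winning strategy in the (n,q)-triangle game with bias q = ⌈√((8/3 + ε*)·n)⌉; that is, there is a Breaker strategy that defeats every Maker strategy. -/
/-!
# The (n,q)-triangle game

The game is played on the edge set of the complete graph `K_n`, modelled as
the non-diagonal elements of `Sym2 (Fin n)`.  The players alternately claim
previously unclaimed edges: Maker moves first and claims one edge, then
Breaker claims `q` edges, and so on; thus, numbering the single-edge moves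
`0, 1, 2, …`, move `k` belongs to Maker iff `k % (q+1) = 0`.  The game ends
when all `n.choose 2` edges are claimed (in particular, in his last batch
Breaker just claims whatever unclaimed edges remain, possibly fewer than
`q`).  Maker wins if at the end three of his edges form a triangle;
otherwise Breaker wins.

A strategy is a function from histories (the finite sequence of edges
claimed so far, in order, which together with `q` determines whose move it
is) to an edge; it is legal if, whenever some edge of `K_n` is still
unclaimed, it picks an unclaimed edge of `K_n`.
-/

/-- The edges of the complete graph `K_n`: non-diagonal elements of `Sym2 (Fin n)`. -/
def IsEdge (n : ℕ) (e : Sym2 (Fin n)) : Prop := ¬ e.IsDiag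

/-- A strategy: a choice of next edge for every history of claimed edges. -/
def Strategy (n : ℕ) : Type := List (Sym2 (Fin n)) → Sym2 (Fin n)

/-- A strategy is legal if, whenever some edge of `K_n` is still unclaimed,
it claims an unclaimed edge of `K_n`. -/
def LegalStrategy (n : ℕ) (s : Strategy n) : Prop :=
  ∀ h : List (Sym2 (Fin n)),
    (∃ e : Sym2 (Fin n), IsEdge n e ∧ e ∉ h) →
    (IsEdge n (s h) ∧ s h ∉ h)

/-- In the game with Breaker-bias `q`, single-edge move number `k`
(0-indexed) belongs to Maker iff `k % (q+1) = 0`: Maker claims one edge,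
then Breaker claims `q` edges, and so on. -/
def IsMakerMove (q k : ℕ) : Prop := k % (q + 1) = 0

/-- The history (list of claimed edges, in order) after `k` single-edge
moves, when Maker plays `sM` and Breaker plays `sB` in the game with
Breaker-bias `q`. -/
def playHist (n q : ℕ) (sM sB : Strategy n) : ℕ → List (Sym2 (Fin n))
  | 0 => []
  | k + 1 =>
      playHist n q sM sB k ++
        [(if k % (q + 1) = 0 then sM else sB) (playHist n q sM sB k)]

/-- The set of edges owned by Maker at the end of the play of `sM` against
`sB`: the game lasts `n.choose 2` single-edge moves (the number of edges of
`K_n`), and Maker owns the edges claimed at moves `k` with `k % (q+1) = 0`. -/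
def MakerOwns (n q : ℕ) (sM sB : Strategy n) (e : Sym2 (Fin n)) : Prop :=
  ∃ k : ℕ, k < n.choose 2 ∧ IsMakerMove q k ∧
    (playHist n q sM sB (n.choose 2))[k]? = some e

/-- Maker wins the play of `sM` against `sB` if at the end of the game
three of his edges form a triangle. -/
def MakerWins (n q : ℕ) (sM sB : Strategy n) : Prop :=
  ∃ a b c : Fin n, a ≠ b ∧ b ≠ c ∧ a ≠ c ∧
    MakerOwns n q sM sB s(a, b) ∧
    MakerOwns n q sM sB s(b, c) ∧
    MakerOwns n q sM sB s(a, c)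

/-- Breaker has a winning strategy in the `(n,q)`-triangle game: a legal
strategy that defeats every legal Maker strategy. -/
def BreakerHasWinningStrategy (n q : ℕ) : Prop :=
  ∃ sB : Strategy n, LegalStrategy n sB ∧
    ∀ sM : Strategy n, LegalStrategy n sM → ¬ MakerWins n q sM sB

def degr {n : ℕ} (S : Finset (Sym2 (Fin n))) (v : Fin n) : ℕ := (S.filter (fun e => v ∈ e)).card

noncomputable def pt {n : ℕ} (a η : ℝ) (M B : Finset (Sym2 (Fin n))) (v : Fin n) : ℝ :=
  Real.exp (η * (a * degr M v - (degr M v : ℝ) ^ 2 / 2 - degr B v))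

noncomputable def vl {n : ℕ} (a η : ℝ) (M B : Finset (Sym2 (Fin n))) (e : Sym2 (Fin n)) : ℝ :=
  ∑ v with v ∈ e, pt a η M B v

noncomputable def Ph {n : ℕ} (a η : ℝ) (M B : Finset (Sym2 (Fin n))) : ℝ :=
  ∑ v, pt a η M B v

def Threat {n : ℕ} (M B : Finset (Sym2 (Fin n))) (e : Sym2 (Fin n)) : Prop :=
  ¬ e.IsDiag ∧ e ∉ M ∧ e ∉ B ∧ ∃ x y z, e = s(x, z) ∧ s(x, y) ∈ M ∧ s(y, z) ∈ M

def Good {n : ℕ} (a η : ℝ) (M B : Finset (Sym2 (Fin n))) (e : Sym2 (Fin n)) : Prop :=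
  ¬ e.IsDiag ∧ e ∉ M ∧ e ∉ B ∧ ((∃ t, Threat M B t) → Threat M B e) ∧
    ((¬ ∃ t, Threat M B t) → ∀ e' : Sym2 (Fin n), ¬ e'.IsDiag → e' ∉ M → e' ∉ B →
      vl a η M B e' ≤ vl a η M B e)

lemma exists_good {n : ℕ} (a η : ℝ) (M B : Finset (Sym2 (Fin n)))
    (h : ∃ e : Sym2 (Fin n), ¬ e.IsDiag ∧ e ∉ M ∧ e ∉ B) : ∃ e, Good a η M B e := by
  classical
  by_cases ht : ∃ t, Threat M B t
  · obtain ⟨t, h1⟩ := ht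
    exact ⟨t, h1.1, h1.2.1, h1.2.2.1, fun _ => h1, fun h2 => (h2 ⟨t, h1⟩).elim⟩
  · obtain ⟨e, he⟩ := h
    obtain ⟨e', h1, h2⟩ := Finset.exists_max_image
      (Finset.univ.filter (fun e : Sym2 (Fin n) => ¬ e.IsDiag ∧ e ∉ M ∧ e ∉ B)) (vl a η M B)
      ⟨e, by simpa using he⟩
    simp only [Finset.mem_filter, Finset.mem_univ, true_and] at h1 h2
    exact ⟨e', h1.1, h1.2.1, h1.2.2, fun h3 => (ht h3).elim,
      fun _ f ha hb hc => h2 f ⟨ha, hb, hc⟩⟩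

lemma pt_pos {n : ℕ} (a η : ℝ) (M B : Finset (Sym2 (Fin n))) (v : Fin n) :
    0 < pt a η M B v := Real.exp_pos _

lemma vl_nonneg {n : ℕ} (a η : ℝ) (M B : Finset (Sym2 (Fin n))) (e : Sym2 (Fin n)) :
    0 ≤ vl a η M B e := Finset.sum_nonneg fun v _ => (pt_pos a η M B v).le

lemma degr_insert {n : ℕ} (S : Finset (Sym2 (Fin n))) (e : Sym2 (Fin n)) (he : e ∉ S)
    (v : Fin n) : degr (insert e S) v = degr S v + if v ∈ e then 1 else 0 := by
  unfold degr
  rw [Finset.filter_insert]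
  split_ifs with h
  · rw [Finset.card_insert_of_notMem (by simp [he])]
  · rfl

lemma degr_mono {n : ℕ} {S T : Finset (Sym2 (Fin n))} (h : S ⊆ T) (v : Fin n) :
    degr S v ≤ degr T v := Finset.card_le_card (Finset.filter_subset_filter _ h)

lemma degr_union {n : ℕ} (S T : Finset (Sym2 (Fin n))) (h : Disjoint S T) (v : Fin n) :
    degr (S ∪ T) v = degr S v + degr T v := by
  unfold degr
  rw [Finset.filter_union, Finset.card_union_of_disjoint (Finset.disjoint_filter_filter h)]

lemma degr_le {n : ℕ} (S : Finset (Sym2 (Fin n))) (v : Fin n) : degr S v ≤ n := by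
  have : S.filter (fun e => v ∈ e) ⊆ Finset.univ.image (fun w : Fin n => s(v, w)) := by
    intro e he
    simp only [Finset.mem_filter] at he
    obtain ⟨w, hw⟩ := he.2
    simp only [Finset.mem_image, Finset.mem_univ, true_and]
    exact ⟨w, hw.symm⟩
  calc degr S v ≤ _ := Finset.card_le_card this
    _ ≤ _ := Finset.card_image_le
    _ = n := by simp

lemma pt_insert {n : ℕ} (a η : ℝ) (M B : Finset (Sym2 (Fin n))) (e : Sym2 (Fin n)) (he : e ∉ B)
    (v : Fin n) : pt a η M (insert e B) v =
      pt a η M B v - if v ∈ e then (1 - Real.exp (-η)) * pt a η M B v else 0 := by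
  unfold pt
  rw [degr_insert B e he]
  split_ifs with h
  · have : (1 - (1 - Real.exp (-η))) = Real.exp (-η) := by ring
    rw [← one_sub_mul, this, ← Real.exp_add]
    congr 1
    push_cast
    ring
  · simp

lemma pt_anti {n : ℕ} (a η : ℝ) (hη : 0 ≤ η) (M B B' : Finset (Sym2 (Fin n))) (h : B ⊆ B')
    (v : Fin n) : pt a η M B' v ≤ pt a η M B v := by
  unfold pt
  have : (degr B v : ℝ) ≤ degr B' v := by exact_mod_cast degr_mono h v
  gcongr

lemma vl_anti {n : ℕ} (a η : ℝ) (hη : 0 ≤ η) (M B B' : Finset (Sym2 (Fin n))) (h : B ⊆ B')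
    (e : Sym2 (Fin n)) : vl a η M B' e ≤ vl a η M B e :=
  Finset.sum_le_sum fun v _ => pt_anti a η hη M B B' h v

lemma Ph_insert {n : ℕ} (a η : ℝ) (M B : Finset (Sym2 (Fin n))) (e : Sym2 (Fin n)) (he : e ∉ B) :
    Ph a η M (insert e B) = Ph a η M B - (1 - Real.exp (-η)) * vl a η M B e := by
  unfold Ph vl
  simp_rw [pt_insert a η M B e he]
  rw [Finset.sum_sub_distrib, Finset.mul_sum, Finset.sum_filter]

lemma numeric (θ δ η q f w m m' : ℝ) (hθ : 0 < θ) (hθ2 : θ ≤ 1 / 2) (hδ : 5 * θ ≤ δ * (1 - θ))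
    (hδ0 : 0 < δ)
    (hq : 1 ≤ q) (hη : η = θ / q) (hf : 0 ≤ f) (hfq : f ≤ q) (hw : 0 ≤ w) (hwm : w ≤ m)
    (hm' : 0 ≤ m') (hm : m' ≤ max 1 (Real.exp (η * (f - δ * q))) * m) :
    (Real.exp (η * (f - δ * q)) - 1) * w - f * (1 - Real.exp (-η)) * m' + 2 * θ * m'
      ≤ 2 * θ * m := by
  have hη0 : 0 < η := by rw [hη]; positivity
  have hqη : η * q = θ := by rw [hη]; field_simp
  have hηθ : η ≤ θ := by rw [← hqη]; nlinarith
  have hb : η * (1 - θ) ≤ 1 - Real.exp (-η) := by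
    have := Real.abs_exp_sub_one_sub_id_le (x := -η) (by rw [abs_neg, abs_of_pos hη0]; linarith)
    have := (abs_le.1 this).2
    nlinarith
  have hb0 : 0 ≤ η * (1 - θ) := by
    apply mul_nonneg hη0.le; linarith
  set E := Real.exp (η * (f - δ * q)) with hE
  set b := 1 - Real.exp (-η) with hbdef
  rcases le_or_gt (f - δ * q) 0 with hA | hA
  · have hE1 : E ≤ 1 := by
      rw [hE]; apply Real.exp_le_one_iff.2
      exact mul_nonpos_of_nonneg_of_nonpos hη0.le hA
    rw [max_eq_left hE1] at hm
    have h1 : (E - 1) * w ≤ 0 := mul_nonpos_of_nonpos_of_nonneg (by linarith) hw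
    have h2 : 0 ≤ f * b * m' := by
      have : 0 ≤ b := hb0.trans hb
      positivity
    nlinarith
  · set A := f - δ * q with hAdef
    have hE1 : 1 ≤ E := by
      rw [hE]; apply Real.one_le_exp; positivity
    rw [max_eq_right hE1] at hm
    have hAq : A ≤ q := by nlinarith
    have hx : η * A ≤ θ := by rw [← hqη]; gcongr
    have hx0 : 0 < η * A := by positivity
    have ha : E - 1 ≤ η * A * (1 + θ) := by
      have := Real.abs_exp_sub_one_sub_id_le (x := η * A) (by rw [abs_of_pos hx0]; linarith)
      have := (abs_le.1 this).2
      nlinarith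
    have hm0 : 0 ≤ m := hw.trans hwm
    have ha2 : E - 1 ≤ 2 * θ := by nlinarith
    have hbf : f * (η * (1 - θ)) ≤ f * b := by gcongr
    have hkey : (E - 1) * (1 + 2 * θ) ≤ f * b := by
      have h1 : (E - 1) * (1 + 2 * θ) ≤ η * A * (1 + θ) * (1 + 2 * θ) := by gcongr
      have h2 : η * A * (1 + θ) * (1 + 2 * θ) ≤ f * (η * (1 - θ)) := by
        have hfA : f = A + δ * q := by rw [hAdef]; ring
        rw [hfA]
        have : A * (1 + θ) * (1 + 2 * θ) ≤ (A + δ * q) * (1 - θ) := by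
          have h3 : A * (4 * θ + 2 * θ ^ 2) ≤ q * (5 * θ) := by
            apply mul_le_mul hAq _ (by positivity) (by positivity)
            nlinarith
          nlinarith
        nlinarith
      linarith
    have hw2 : (E - 1) * w ≤ (E - 1) * m := by gcongr
    -- (E-1) m + (2θ - f b) m' ≤ 2θ m
    have hmain : (E - 1) * m + (2 * θ - f * b) * m' ≤ 2 * θ * m := by
      rcases le_or_gt (2 * θ - f * b) 0 with hc | hc
      · have := mul_nonpos_of_nonpos_of_nonneg hc hm'
        nlinarith
      · have h1 : (2 * θ - f * b) * m' ≤ (2 * θ - f * b) * (E * m) := by gcongr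
        have h2 : (E - 1) + (2 * θ - f * b) * E ≤ 2 * θ := by
          have h5 : 0 ≤ f * b := mul_nonneg hf (hb0.trans hb)
          have h6 : 0 ≤ f * b * (E - 1) := mul_nonneg h5 (by linarith)
          linarith
        have h7 := mul_le_mul_of_nonneg_right h2 hm0
        linarith
    linarith

structure GInv {n : ℕ} (q : ℕ) (a η θ : ℝ) (M B : Finset (Sym2 (Fin n))) (m : ℝ) : Prop where
  disj : ∀ e ∈ M, e ∉ B
  eM : ∀ e ∈ M, ¬ e.IsDiag
  closed : ∀ x y z, x ≠ z → s(x, y) ∈ M → s(y, z) ∈ M → s(x, z) ∈ B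
  deg : ∀ v, 2 * degr M v ≤ q
  hm : 0 ≤ m
  bd : ∀ e : Sym2 (Fin n), ¬ e.IsDiag → e ∉ M → e ∉ B → vl a η M B e ≤ m
  pot : Ph a η M B + 2 * θ * m ≤ n + 2

/-- Maker's set after his move has no triangle. -/
lemma no_tri {n : ℕ} (M B : Finset (Sym2 (Fin n))) (disj : ∀ e ∈ M, e ∉ B)
    (closed : ∀ x y z, x ≠ z → s(x, y) ∈ M → s(y, z) ∈ M → s(x, z) ∈ B)
    (e0 : Sym2 (Fin n)) (h0B : e0 ∉ B) (x y z : Fin n) (hxy : x ≠ y) (hyz : y ≠ z) (hxz : x ≠ z)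
    (h1 : s(x, y) ∈ insert e0 M) (h2 : s(y, z) ∈ insert e0 M) (h3 : s(x, z) ∈ insert e0 M) :
    False := by
  have hins : ∀ e ∈ insert e0 M, e ∉ B := by
    intro e he
    rcases Finset.mem_insert.1 he with rfl | he
    · exact h0B
    · exact disj e he
  have n12 : s(x, y) ≠ s(y, z) := by
    intro h; rw [Sym2.eq_iff] at h; grind
  have n13 : s(x, y) ≠ s(x, z) := by
    intro h; rw [Sym2.eq_iff] at h; grind
  have n23 : s(y, z) ≠ s(x, z) := by
    intro h; rw [Sym2.eq_iff] at h; grind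
  by_cases k1 : s(x, y) ∈ M
  · by_cases k2 : s(y, z) ∈ M
    · exact hins _ h3 (closed x y z hxz k1 k2)
    · have k3 : s(x, z) ∈ M := by
        rcases Finset.mem_insert.1 h2 with h | h
        · rcases Finset.mem_insert.1 h3 with h' | h'
          · exact (n23 (h.trans h'.symm)).elim
          · exact h'
        · exact (k2 h).elim
      exact hins _ h2 (closed y x z hyz (by rwa [Sym2.eq_swap]) k3)
  · have h : s(x, y) = e0 := (Finset.mem_insert.1 h1).resolve_right k1
    have k2 : s(y, z) ∈ M := (Finset.mem_insert.1 h2).resolve_left (fun h' => n12 (h.trans h'.symm))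
    have k3 : s(x, z) ∈ M := (Finset.mem_insert.1 h3).resolve_left (fun h' => n13 (h.trans h'.symm))
    exact hins _ h1 (closed x z y hxy k3 (by rwa [Sym2.eq_swap]))

/-- Shape of threats after Maker plays `uv`. -/
lemma threat_shape {n : ℕ} (M B : Finset (Sym2 (Fin n)))
    (closed : ∀ x y z, x ≠ z → s(x, y) ∈ M → s(y, z) ∈ M → s(x, z) ∈ B)
    (u v : Fin n) (e : Sym2 (Fin n)) (ht : Threat (insert s(u, v) M) B e) :
    (∃ w, e = s(u, w) ∧ s(v, w) ∈ M) ∨ (∃ w, e = s(v, w) ∧ s(u, w) ∈ M) := by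
  obtain ⟨hd, hM, hB, x, y, z, rfl, h1, h2⟩ := ht
  have hxz : x ≠ z := by simpa using hd
  have ne : s(x, y) ≠ s(y, z) := by
    intro h; rw [Sym2.eq_iff] at h; grind
  rcases Finset.mem_insert.1 h1 with k1 | k1
  · have k2 : s(y, z) ∈ M := (Finset.mem_insert.1 h2).resolve_left (fun h' => ne (k1.trans h'.symm))
    rcases Sym2.eq_iff.1 k1 with ⟨rfl, rfl⟩ | ⟨rfl, rfl⟩
    · exact Or.inl ⟨z, rfl, k2⟩
    · exact Or.inr ⟨z, rfl, k2⟩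
  · rcases Finset.mem_insert.1 h2 with k2 | k2
    · rcases Sym2.eq_iff.1 k2 with ⟨rfl, rfl⟩ | ⟨rfl, rfl⟩
      · exact Or.inr ⟨x, Sym2.eq_swap, by rwa [Sym2.eq_swap]⟩
      · exact Or.inl ⟨x, Sym2.eq_swap, by rwa [Sym2.eq_swap]⟩
    · exact (hB (closed x y z hxz k1 k2)).elim

lemma threat_deg {n : ℕ} (M B C : Finset (Sym2 (Fin n))) (eM : ∀ e ∈ M, ¬ e.IsDiag)
    (closed : ∀ x y z, x ≠ z → s(x, y) ∈ M → s(y, z) ∈ M → s(x, z) ∈ B)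
    (u v : Fin n) (huv : u ≠ v) (hC : ∀ e, e ∈ C ↔ Threat (insert s(u, v) M) B e) :
    degr C u ≤ degr M v := by
  have : C.filter (fun e => u ∈ e) ⊆
      (M.filter (fun e => v ∈ e)).image (Sym2.map (Equiv.swap u v)) := by
    intro e he
    simp only [Finset.mem_filter, Finset.mem_image] at he ⊢
    obtain ⟨he, hu⟩ := he
    have ht := (hC e).1 he
    rcases threat_shape M B closed u v e ht with ⟨w, rfl, hw⟩ | ⟨w, rfl, hw⟩
    · refine ⟨s(v, w), ⟨hw, by simp⟩, ?_⟩
      have h1 : w ≠ v := by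
        rintro rfl; exact eM _ hw (by simp)
      have h2 : w ≠ u := by
        rintro rfl; exact ht.1 (by simp)
      simp [Equiv.swap_apply_of_ne_of_ne h2 h1]
    · exfalso
      rw [Sym2.mem_iff] at hu
      rcases hu with h | h
      · exact huv h
      · subst h; exact eM _ hw (by simp)
  exact (Finset.card_le_card this).trans Finset.card_image_le

lemma threat_card {n : ℕ} (M B C : Finset (Sym2 (Fin n)))
    (closed : ∀ x y z, x ≠ z → s(x, y) ∈ M → s(y, z) ∈ M → s(x, z) ∈ B)
    (u v : Fin n) (huv : u ≠ v) (hC : ∀ e, e ∈ C ↔ Threat (insert s(u, v) M) B e) :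
    C.card = degr C u + degr C v := by
  unfold degr
  rw [← Finset.card_union_of_disjoint, ← Finset.filter_or, Finset.filter_true_of_mem]
  · intro e he
    rcases threat_shape M B closed u v e ((hC e).1 he) with ⟨w, rfl, hw⟩ | ⟨w, rfl, hw⟩
    · left; simp
    · right; simp
  · rw [Finset.disjoint_left]
    intro e h1 h2
    simp only [Finset.mem_filter] at h1 h2
    have : e = s(u, v) := (Sym2.mem_and_mem_iff huv).1 ⟨h1.2, h2.2⟩
    exact ((hC e).1 h1.1).2.1 (by simp [this])

/-- potential after Maker's move and closing edges -/
lemma pt_step {n : ℕ} (q : ℕ) (a η δ : ℝ) (hη : 0 ≤ η) (ha : a = (1 - δ) * q)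
    (M B C : Finset (Sym2 (Fin n))) (eM : ∀ e ∈ M, ¬ e.IsDiag)
    (closed : ∀ x y z, x ≠ z → s(x, y) ∈ M → s(y, z) ∈ M → s(x, z) ∈ B)
    (e0 : Sym2 (Fin n)) (h0 : ¬ e0.IsDiag) (h0M : e0 ∉ M)
    (hC : ∀ e, e ∈ C ↔ Threat (insert e0 M) B e) (w : Fin n) :
    pt a η (insert e0 M) (B ∪ C) w ≤
      pt a η M B w + if w ∈ e0 then
        (Real.exp (η * (((q : ℝ) - C.card) - δ * q)) - 1) * pt a η M B w else 0 := by
  have hBC : Disjoint B C := by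
    rw [Finset.disjoint_right]
    intro e he
    exact ((hC e).1 he).2.2.1
  have key : ∀ u v : Fin n, u ≠ v → e0 = s(u, v) → C.card ≤ degr M u + degr C u := by
    rintro u v huv rfl
    rw [threat_card M B C closed u v huv hC]
    have := threat_deg M B C eM closed v u huv.symm (by rwa [Sym2.eq_swap])
    omega
  split_ifs with hw
  · obtain ⟨v, rfl⟩ := hw
    have hne : w ≠ v := by simpa using h0
    have hk : (C.card : ℝ) ≤ degr M w + degr C w := by exact_mod_cast key w v hne rfl
    rw [← one_add_mul, add_sub_cancel]
    unfold pt
    rw [← Real.exp_add, ← mul_add, degr_insert _ _ h0M, degr_union _ _ hBC, ha]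
    apply Real.exp_le_exp.2
    apply mul_le_mul_of_nonneg_left _ hη
    simp only [Sym2.mem_mk_left, if_true]
    push_cast
    nlinarith
  · rw [add_zero]
    unfold pt
    rw [degr_insert _ _ h0M, degr_union _ _ hBC]
    apply Real.exp_le_exp.2
    apply mul_le_mul_of_nonneg_left _ hη
    simp only [hw, if_false]
    push_cast
    have : (0 : ℝ) ≤ degr C w := by positivity
    linarith

lemma phase1 {n : ℕ} (q : ℕ) (a η : ℝ) (M B C : Finset (Sym2 (Fin n)))
    (hC : ∀ e, e ∈ C ↔ Threat M B e) (β : ℕ → Finset (Sym2 (Fin n))) (g : ℕ → Sym2 (Fin n))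
    (h0 : β 0 = B) (hs : ∀ j < q, β (j + 1) = insert (g j) (β j))
    (hg : ∀ j < q, Good a η M (β j) (g j)) (hc : C.card ≤ q) :
    β C.card = B ∪ C := by
  have key : ∀ j ≤ C.card, ∃ X ⊆ C, X.card = j ∧ β j = B ∪ X := by
    intro j
    induction j with
    | zero => intro _; exact ⟨∅, by simp, by simp, by simp [h0]⟩
    | succ j ih =>
      intro hj
      obtain ⟨X, hX, hXc, hβ⟩ := ih (by omega)
      have hjq : j < q := by omega
      obtain ⟨t, htC, htX⟩ := Finset.exists_mem_notMem_of_card_lt_card (s := X) (t := C) (by omega)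
      have ht := (hC t).1 htC
      have hG := hg j hjq
      rw [hβ] at hG
      have h1 := hG.2.2.2.1 ⟨t, ht.1, ht.2.1, by simp [ht.2.2.1, htX], ht.2.2.2⟩
      have h2 : g j ∉ B ∧ g j ∉ X := by simpa using h1.2.2.1
      have h3 : g j ∈ C := (hC _).2 ⟨h1.1, h1.2.1, h2.1, h1.2.2.2⟩
      refine ⟨insert (g j) X, ?_, ?_, ?_⟩
      · exact Finset.insert_subset h3 hX
      · rw [Finset.card_insert_of_notMem h2.2, hXc]
      · rw [hs j hjq, hβ, Finset.union_insert]
  obtain ⟨X, hX, hXc, hβ⟩ := key _ le_rfl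
  rw [hβ, Finset.eq_of_subset_of_card_le hX hXc.ge]

lemma phase2 {n : ℕ} (q : ℕ) (a η : ℝ) (hη : 0 ≤ η) (M B1 : Finset (Sym2 (Fin n))) (c : ℕ)
    (hno : ∀ e, ¬ Threat M B1 e) (β : ℕ → Finset (Sym2 (Fin n))) (g : ℕ → Sym2 (Fin n))
    (h0 : β c = B1) (hs : ∀ j < q, β (j + 1) = insert (g j) (β j))
    (hg : ∀ j < q, Good a η M (β j) (g j)) (m1 : ℝ) (hm1 : 0 ≤ m1)
    (hbd : ∀ e : Sym2 (Fin n), ¬ e.IsDiag → e ∉ M → e ∉ B1 → vl a η M B1 e ≤ m1) :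
    ∀ i, c + i ≤ q → B1 ⊆ β (c + i) ∧ ∃ m, 0 ≤ m ∧ m ≤ m1 ∧
      (∀ e : Sym2 (Fin n), ¬ e.IsDiag → e ∉ M → e ∉ β (c + i) → vl a η M (β (c + i)) e ≤ m) ∧
      Ph a η M (β (c + i)) + i * (1 - Real.exp (-η)) * m ≤ Ph a η M B1 := by
  intro i
  have hb : 0 ≤ 1 - Real.exp (-η) := by
    have := Real.exp_le_one_iff.2 (neg_nonpos.2 hη)
    linarith
  induction i with
  | zero =>
    intro _
    rw [add_zero, h0]
    exact ⟨subset_rfl, m1, hm1, le_rfl, hbd, by simp⟩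
  | succ i ih =>
    intro hi
    obtain ⟨hsub, m, hm0, hmm, hb1, hP⟩ := ih (by omega)
    have hlt : c + i < q := by omega
    have hG := hg _ hlt
    have hstep := hs _ hlt
    rw [← add_assoc, hstep]
    have hsub2 : β (c + i) ⊆ insert (g (c + i)) (β (c + i)) := Finset.subset_insert _ _
    have hno' : ¬ ∃ t, Threat M (β (c + i)) t := by
      rintro ⟨t, ht⟩
      exact hno t ⟨ht.1, ht.2.1, fun h => ht.2.2.1 (hsub h), ht.2.2.2⟩
    have hmax := hG.2.2.2.2 hno'
    refine ⟨hsub.trans hsub2, vl a η M (β (c + i)) (g (c + i)), vl_nonneg _ _ _ _ _, ?_, ?_, ?_⟩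
    · exact (hb1 _ hG.1 hG.2.1 hG.2.2.1).trans hmm
    · intro e h1 h2 h3
      exact (vl_anti a η hη M _ _ hsub2 e).trans (hmax e h1 h2 (fun h => h3 (hsub2 h)))
    · rw [Ph_insert a η M _ _ hG.2.2.1]
      have h1 := hb1 _ hG.1 hG.2.1 hG.2.2.1
      have h2 : i * (1 - Real.exp (-η)) * vl a η M (β (c + i)) (g (c + i)) ≤
        i * (1 - Real.exp (-η)) * m := by gcongr
      push_cast
      linarith

lemma game_round {n : ℕ} (q : ℕ) (a η θ δ : ℝ) (hθ : 0 < θ) (hθ2 : θ ≤ 1 / 2)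
    (hδ : 5 * θ ≤ δ * (1 - θ)) (hδ0 : 0 < δ) (hq : 1 ≤ q) (hη : η = θ / q) (ha : a = (1 - δ) * q)
    (hP : ∀ d : ℕ, q < 2 * d → 2 * d ≤ q + 2 →
      (n : ℝ) + Real.log (n + 2) / η < a * d - (d : ℝ) ^ 2 / 2)
    (M B : Finset (Sym2 (Fin n))) (m : ℝ) (I : GInv q a η θ M B m)
    (e0 : Sym2 (Fin n)) (h0 : ¬ e0.IsDiag) (h0M : e0 ∉ M) (h0B : e0 ∉ B)
    (β : ℕ → Finset (Sym2 (Fin n))) (g : ℕ → Sym2 (Fin n))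
    (hβ0 : β 0 = B) (hs : ∀ j < q, β (j + 1) = insert (g j) (β j))
    (hg : ∀ j < q, Good a η (insert e0 M) (β j) (g j)) :
    ∃ m', GInv q a η θ (insert e0 M) (β q) m' := by
  classical
  have hq' : (1 : ℝ) ≤ q := by exact_mod_cast hq
  have hη0 : 0 < η := by rw [hη]; positivity
  set C : Finset (Sym2 (Fin n)) := Finset.univ.filter (Threat (insert e0 M) B) with hCdef
  have hC : ∀ e, e ∈ C ↔ Threat (insert e0 M) B e := by simp [hCdef]
  have hcard : C.card ≤ q := by
    induction e0 using Sym2.ind with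
    | _ u v =>
      have huv : u ≠ v := by simpa using h0
      rw [threat_card M B C I.closed u v huv hC]
      have h1 := threat_deg M B C I.eM I.closed u v huv hC
      have h2 := threat_deg M B C I.eM I.closed v u huv.symm (by rwa [Sym2.eq_swap])
      have h3 := I.deg u
      have h4 := I.deg v
      omega
  have hstep := pt_step q a η δ hη0.le ha M B C I.eM I.closed e0 h0 h0M hC
  set f : ℝ := (q : ℝ) - C.card with hf
  set E := Real.exp (η * (f - δ * q)) with hE
  have hf0 : 0 ≤ f := by rw [hf, sub_nonneg]; exact_mod_cast hcard
  have hfq : f ≤ q := by rw [hf]; simp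
  have hPh1 : Ph a η (insert e0 M) (B ∪ C) ≤ Ph a η M B + (E - 1) * vl a η M B e0 := by
    unfold Ph vl
    rw [Finset.mul_sum, Finset.sum_filter, ← Finset.sum_add_distrib]
    exact Finset.sum_le_sum fun w _ => hstep w
  have hvl : ∀ e, vl a η (insert e0 M) (B ∪ C) e ≤ max 1 E * vl a η M B e := by
    intro e
    unfold vl
    rw [Finset.mul_sum]
    refine Finset.sum_le_sum fun w _ => (hstep w).trans ?_
    have hp := (pt_pos a η M B w).le
    split_ifs
    · have := mul_le_mul_of_nonneg_right (le_max_right 1 E) hp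
      linarith
    · have := mul_le_mul_of_nonneg_right (le_max_left 1 E) hp
      linarith
  have hβc := phase1 q a η (insert e0 M) B C hC β g hβ0 hs hg hcard
  have hno : ∀ e, ¬ Threat (insert e0 M) (B ∪ C) e := by
    intro e ht
    have h2 : e ∉ B ∧ e ∉ C := by simpa using ht.2.2.1
    exact h2.2 ((hC e).2 ⟨ht.1, ht.2.1, h2.1, ht.2.2.2⟩)
  obtain ⟨hsub, m', hm0, hmm, hbd, hPh⟩ := phase2 q a η hη0.le (insert e0 M) (B ∪ C) C.card hno β g
    hβc hs hg (max 1 E * m) (mul_nonneg (by positivity) I.hm) (by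
      intro e h1 h2 h3
      refine (hvl e).trans ?_
      gcongr
      exact I.bd e h1 (fun h => h2 (Finset.mem_insert_of_mem h))
        (fun h => h3 (Finset.mem_union_left _ h))) (q - C.card) (by omega)
  rw [Nat.add_sub_cancel' hcard] at hsub hbd hPh
  have hcast : ((q - C.card : ℕ) : ℝ) = f := by rw [Nat.cast_sub hcard]
  rw [hcast] at hPh
  have hnum := numeric θ δ η q f (vl a η M B e0) m m' hθ hθ2 hδ hδ0 hq' hη hf0 hfq
    (vl_nonneg _ _ _ _ _) (I.bd e0 h0 h0M h0B) hm0 hmm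
  have hpot : Ph a η (insert e0 M) (β q) + 2 * θ * m' ≤ n + 2 := by
    have := I.pot
    linarith
  have hdisj0 : ∀ j ≤ q, ∀ e ∈ insert e0 M, e ∉ β j := by
    intro j
    induction j with
    | zero =>
      intro _ e he
      rw [hβ0]
      rcases Finset.mem_insert.1 he with rfl | he
      · exact h0B
      · exact I.disj e he
    | succ j ih =>
      intro hj e he h
      rw [hs j (by omega)] at h
      rcases Finset.mem_insert.1 h with rfl | h
      · exact (hg j (by omega)).2.1 he
      · exact ih (by omega) e he h
  refine ⟨m', hdisj0 q le_rfl, ?_, ?_, ?_, hm0, hbd, hpot⟩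
  · intro e he
    rcases Finset.mem_insert.1 he with rfl | he
    · exact h0
    · exact I.eM e he
  · intro x y z hxz h1 h2
    apply hsub
    by_contra hcon
    have eM' : ∀ e ∈ insert e0 M, ¬ e.IsDiag := by
      intro e he
      rcases Finset.mem_insert.1 he with rfl | he
      · exact h0
      · exact I.eM e he
    refine hno s(x, z) ⟨by simpa using hxz, ?_, hcon, x, y, z, rfl, h1, h2⟩
    intro h3
    exact no_tri M B I.disj I.closed e0 h0B x y z (by simpa using eM' _ h1)
      (by simpa using eM' _ h2) hxz h1 h2 h3
  · intro v
    by_contra hcon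
    push Not at hcon
    have hd : degr (insert e0 M) v ≤ degr M v + 1 := by
      rw [degr_insert _ _ h0M]; split_ifs <;> omega
    have h1 := hP _ hcon (by have := I.deg v; omega)
    have h2 : pt a η (insert e0 M) (β q) v ≤ n + 2 := by
      have h3 : pt a η (insert e0 M) (β q) v ≤ Ph a η (insert e0 M) (β q) :=
        Finset.single_le_sum (f := fun v => pt a η (insert e0 M) (β q) v)
          (fun w _ => (pt_pos _ _ _ _ w).le) (Finset.mem_univ v)
      have : 0 ≤ 2 * θ * m' := by positivity
      linarith
    unfold pt at h2
    rw [← Real.le_log_iff_exp_le (by positivity), ← le_div_iff₀' hη0] at h2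
    have h3 : (degr (β q) v : ℝ) ≤ n := by exact_mod_cast degr_le (β q) v
    linarith

def Ms {n : ℕ} (q : ℕ) (e : ℕ → Sym2 (Fin n)) (k : ℕ) : Finset (Sym2 (Fin n)) :=
  ((Finset.range k).filter (fun i => i % (q + 1) = 0)).image e

def Bs {n : ℕ} (q : ℕ) (e : ℕ → Sym2 (Fin n)) (k : ℕ) : Finset (Sym2 (Fin n)) :=
  ((Finset.range k).filter (fun i => ¬ i % (q + 1) = 0)).image e

lemma Ms_succ {n : ℕ} (q : ℕ) (e : ℕ → Sym2 (Fin n)) (k : ℕ) :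
    Ms q e (k + 1) = if k % (q + 1) = 0 then insert (e k) (Ms q e k) else Ms q e k := by
  unfold Ms
  rw [Finset.range_add_one, Finset.filter_insert]
  split_ifs <;> simp

lemma Bs_succ {n : ℕ} (q : ℕ) (e : ℕ → Sym2 (Fin n)) (k : ℕ) :
    Bs q e (k + 1) = if k % (q + 1) = 0 then Bs q e k else insert (e k) (Bs q e k) := by
  unfold Bs
  rw [Finset.range_add_one, Finset.filter_insert]
  split_ifs <;> simp

lemma Ms_round {n : ℕ} (q : ℕ) (e : ℕ → Sym2 (Fin n)) (t j : ℕ) (hj : j ≤ q) :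
    Ms q e (t * (q + 1) + 1 + j) = insert (e (t * (q + 1))) (Ms q e (t * (q + 1))) := by
  induction j with
  | zero => rw [add_zero, Ms_succ, if_pos (by simp)]
  | succ j ih =>
    rw [← add_assoc, Ms_succ, if_neg, ih (by omega)]
    rw [add_assoc, Nat.mul_add_mod_self_right, Nat.mod_eq_of_lt (by omega)]
    omega

lemma all_inv {n : ℕ} (q : ℕ) (a η θ δ : ℝ) (hθ : 0 < θ) (hθ2 : θ ≤ 1 / 2)
    (hδ : 5 * θ ≤ δ * (1 - θ)) (hδ0 : 0 < δ) (hq : 1 ≤ q) (hη : η = θ / q) (ha : a = (1 - δ) * q)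
    (hP : ∀ d : ℕ, q < 2 * d → 2 * d ≤ q + 2 →
      (n : ℝ) + Real.log (n + 2) / η < a * d - (d : ℝ) ^ 2 / 2)
    (e : ℕ → Sym2 (Fin n)) (T : ℕ)
    (hedge : ∀ k < T, ¬ (e k).IsDiag ∧ e k ∉ Ms q e k ∧ e k ∉ Bs q e k)
    (hgood : ∀ k < T, ¬ k % (q + 1) = 0 → Good a η (Ms q e k) (Bs q e k) (e k)) :
    ∀ t, t * (q + 1) ≤ T → ∃ m, GInv q a η θ (Ms q e (t * (q + 1))) (Bs q e (t * (q + 1))) m := by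
  intro t
  induction t with
  | zero =>
    intro _
    have hp : ∀ v : Fin n, pt a η ∅ ∅ v = 1 := by
      intro v; simp [pt, degr]
    refine ⟨2, ?_⟩
    have h1 : Ms q e (0 * (q + 1)) = ∅ := by simp [Ms]
    have h2 : Bs q e (0 * (q + 1)) = ∅ := by simp [Bs]
    rw [h1, h2]
    refine ⟨by simp, by simp, by simp, by simp [degr], by norm_num, ?_, ?_⟩
    · intro e _ _ _
      unfold vl
      simp_rw [hp]
      rw [Finset.sum_const, nsmul_eq_mul, mul_one]
      induction e using Sym2.ind with
      | _ u v =>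
        have : (Finset.univ.filter (fun w : Fin n => w ∈ s(u, v))) ⊆ {u, v} := by
          intro w; simp
        have := (Finset.card_le_card this).trans Finset.card_le_two
        exact_mod_cast this
    · unfold Ph
      simp_rw [hp]
      simp
      linarith
  | succ t ih =>
    intro ht
    have he : (t + 1) * (q + 1) = t * (q + 1) + 1 + q := by ring
    rw [he] at ht ⊢
    obtain ⟨m, I⟩ := ih (by omega)
    have hk := hedge (t * (q + 1)) (by omega)
    have hmod : ∀ j < q, ¬ (t * (q + 1) + 1 + j) % (q + 1) = 0 := by
      intro j hj
      rw [add_assoc, Nat.mul_add_mod_self_right, Nat.mod_eq_of_lt (by omega)]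
      omega
    rw [Ms_round q e t q le_rfl]
    refine game_round q a η θ δ hθ hθ2 hδ hδ0 hq hη ha hP _ _ m I _ hk.1 hk.2.1 hk.2.2
      (fun j => Bs q e (t * (q + 1) + 1 + j)) (fun j => e (t * (q + 1) + 1 + j)) ?_ ?_ ?_
    · show Bs q e (t * (q + 1) + 1) = _
      rw [Bs_succ, if_pos (by simp)]
    · intro j hj
      show Bs q e (t * (q + 1) + 1 + j + 1) = _
      rw [Bs_succ, if_neg (hmod j hj)]
    · intro j hj
      rw [← Ms_round q e t j hj.le]
      exact hgood _ (by omega) (hmod j hj)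

lemma final_no_tri {n : ℕ} (q : ℕ) (a η θ δ : ℝ) (hθ : 0 < θ) (hθ2 : θ ≤ 1 / 2)
    (hδ : 5 * θ ≤ δ * (1 - θ)) (hδ0 : 0 < δ) (hq : 1 ≤ q) (hη : η = θ / q) (ha : a = (1 - δ) * q)
    (hP : ∀ d : ℕ, q < 2 * d → 2 * d ≤ q + 2 →
      (n : ℝ) + Real.log (n + 2) / η < a * d - (d : ℝ) ^ 2 / 2)
    (e : ℕ → Sym2 (Fin n)) (T : ℕ)
    (hedge : ∀ k < T, ¬ (e k).IsDiag ∧ e k ∉ Ms q e k ∧ e k ∉ Bs q e k)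
    (hgood : ∀ k < T, ¬ k % (q + 1) = 0 → Good a η (Ms q e k) (Bs q e k) (e k))
    (x y z : Fin n) (hxy : x ≠ y) (hyz : y ≠ z) (hxz : x ≠ z)
    (h1 : s(x, y) ∈ Ms q e T) (h2 : s(y, z) ∈ Ms q e T) (h3 : s(x, z) ∈ Ms q e T) : False := by
  have hdiv := Nat.div_add_mod' T (q + 1)
  have hlt : T % (q + 1) < q + 1 := Nat.mod_lt T (Nat.succ_pos q)
  obtain ⟨m, I⟩ := all_inv q a η θ δ hθ hθ2 hδ hδ0 hq hη ha hP e T hedge hgood (T / (q + 1))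
    (by omega)
  rcases Nat.eq_zero_or_pos (T % (q + 1)) with h0 | h0
  · rw [h0, add_zero] at hdiv
    rw [hdiv] at I
    exact I.disj _ h3 (I.closed x y z hxz h1 h2)
  · have hT : T = T / (q + 1) * (q + 1) + 1 + (T % (q + 1) - 1) := by omega
    have hM := Ms_round q e (T / (q + 1)) (T % (q + 1) - 1) (by omega)
    rw [← hT] at hM
    rw [hM] at h1 h2 h3
    exact no_tri _ _ I.disj I.closed _ (hedge (T / (q + 1) * (q + 1)) (by omega)).2.2 x y z
      hxy hyz hxz h1 h2 h3

lemma params (ε : ℝ) (hε : 0 < ε) : ∃ θ δ : ℝ, 0 < θ ∧ θ ≤ 1 / 2 ∧ 5 * θ ≤ δ * (1 - θ) ∧ 0 < δ ∧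
    ∃ N : ℕ, ∀ n : ℕ, N ≤ n → ∀ q : ℕ, q = ⌈Real.sqrt ((8 / 3 + ε) * n)⌉₊ → 1 ≤ n ∧ 1 ≤ q ∧
    ∀ d : ℕ, q < 2 * d → 2 * d ≤ q + 2 →
      (n : ℝ) + Real.log (n + 2) / (θ / q) < ((1 - δ) * q) * d - (d : ℝ) ^ 2 / 2 := by
  set K : ℝ := 8 / 3 + ε with hK
  have hK0 : 0 < K := by positivity
  set δ : ℝ := (3 / 8 * ε) / K with hδd
  have hδ0 : 0 < δ := by positivity
  have hδK : δ * K = 3 / 8 * ε := by rw [hδd]; field_simp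
  have hδ1 : δ ≤ 3 / 8 := by
    rw [hδd, div_le_iff₀ hK0]; nlinarith
  set θ : ℝ := δ / 10 with hθd
  have hθ0 : 0 < θ := by positivity
  set c : ℝ := Real.sqrt K + 1 with hc
  have hc0 : 0 < c := by positivity
  set c' : ℝ := 3 * ε / (16 * c) with hc'
  have hc'0 : 0 < c' := by positivity
  have hcc : c * c' = 3 * ε / 16 := by rw [hc']; field_simp
  refine ⟨θ, δ, hθ0, by rw [hθd]; linarith, by rw [hθd]; nlinarith, hδ0, ?_⟩
  have hlog : ∀ᶠ x : ℝ in Filter.atTop, Real.log x ≤ (θ * c' / 8) * Real.sqrt x := by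
    have := (isLittleO_log_rpow_atTop (r := 1 / 2) (by norm_num)).bound
      (c := θ * c' / 8) (by positivity)
    filter_upwards [this, Filter.eventually_ge_atTop 1] with x hx h1
    rw [← Real.sqrt_eq_rpow, Real.norm_of_nonneg (Real.sqrt_nonneg _)] at hx
    exact (le_abs_self _).trans hx
  obtain ⟨X, hX⟩ := Filter.eventually_atTop.1 hlog
  refine ⟨⌈X⌉₊ + ⌈(1 / c') ^ 2⌉₊ + 4, fun n hn q hq => ?_⟩
  have hnR : (⌈X⌉₊ : ℝ) + (⌈(1 / c') ^ 2⌉₊ : ℝ) + 4 ≤ n := by exact_mod_cast hn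
  have hx1 := Nat.le_ceil X
  have hx2 := Nat.le_ceil ((1 / c') ^ 2)
  have hx3 : (0 : ℝ) ≤ (⌈X⌉₊ : ℝ) := by positivity
  have hx4 : (0 : ℝ) ≤ (⌈(1 / c') ^ 2⌉₊ : ℝ) := by positivity
  have hn4 : (4 : ℝ) ≤ n := by linarith
  have hnX : X ≤ (n : ℝ) + 2 := by linarith
  have hnc : (1 / c') ≤ Real.sqrt n := by
    apply Real.le_sqrt_of_sq_le; linarith
  have hl := hX _ hnX
  set s := Real.sqrt n with hs
  have hs2 : s ^ 2 = n := Real.sq_sqrt (by linarith)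
  have hs0 : 2 ≤ s := by
    apply Real.le_sqrt_of_sq_le; linarith
  have hl2 : Real.sqrt ((n : ℝ) + 2) ≤ 2 * s := by
    rw [Real.sqrt_le_left (by linarith)]
    nlinarith
  have hqlo : Real.sqrt (K * n) ≤ q := by rw [hq]; exact Nat.le_ceil _
  have hqhi : (q : ℝ) < Real.sqrt (K * n) + 1 := by
    rw [hq]; exact Nat.ceil_lt_add_one (Real.sqrt_nonneg _)
  have hKn : Real.sqrt (K * n) = Real.sqrt K * s := Real.sqrt_mul hK0.le _
  have hq2 : K * n ≤ (q : ℝ) ^ 2 := by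
    rw [← Real.sq_sqrt (show 0 ≤ K * (n : ℝ) by positivity)]
    gcongr
  have hq3 : (2 : ℝ) ≤ q := by
    by_contra hcon
    push Not at hcon
    have h1 : (q : ℝ) ^ 2 < 2 ^ 2 := by gcongr
    have h2 : (8 / 3 : ℝ) * 4 ≤ K * n := by
      apply mul_le_mul _ hn4 (by norm_num) hK0.le
      rw [hK]; linarith
    linarith
  have hqc : (q : ℝ) ≤ c * s := by
    have : c * s = Real.sqrt K * s + s := by rw [hc]; ring
    rw [this, ← hKn]; linarith
  refine ⟨by exact_mod_cast (by linarith : (1 : ℝ) ≤ n),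
    by exact_mod_cast (by linarith : (1 : ℝ) ≤ q), fun d hd1 hd2 => ?_⟩
  have hd1' : (q : ℝ) < 2 * d := by exact_mod_cast hd1
  have hd2' : 2 * (d : ℝ) ≤ q + 2 := by exact_mod_cast hd2
  have hlogb : Real.log (n + 2) / θ ≤ c' * s / 4 := by
    rw [div_le_iff₀ hθ0]
    calc _ ≤ _ := hl
      _ ≤ (θ * c' / 8) * (2 * s) := by gcongr
      _ = _ := by ring
  have h14 : 1 ≤ c' * s := by
    rw [div_le_iff₀ hc'0] at hnc; linarith
  have hlog3 : Real.log (n + 2) / (θ / q) = q * (Real.log (n + 2) / θ) := by field_simp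
  rw [hlog3]
  have hsmall : q * (Real.log (n + 2) / θ) + q / 4 < 3 * ε / 16 * n := by
    have h1 : q * (Real.log (n + 2) / θ) + q / 4 ≤ q * (c' * s / 2) := by
      have : q * (Real.log (n + 2) / θ) ≤ q * (c' * s / 4) := by gcongr
      have h5 := mul_le_mul_of_nonneg_left h14 (show (0 : ℝ) ≤ q by linarith)
      linarith
    have h2 : q * (c' * s / 2) ≤ c * s * (c' * s / 2) := by gcongr
    have h3 : c * s * (c' * s / 2) = (c * c') * s ^ 2 / 2 := by ring
    rw [h3, hcc, hs2] at h2
    have : 0 < 3 * ε / 16 * (n : ℝ) := by positivity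
    linarith
  have hmain : (3 / 8 - δ / 2) * (K * n) ≤ (3 / 8 - δ / 2) * (q : ℝ) ^ 2 := by
    apply mul_le_mul_of_nonneg_left hq2; linarith
  have hKval : (3 / 8 - δ / 2) * (K * n) = n + 3 * ε / 16 * n := by
    have : (3 / 8 - δ / 2) * (K * n) = (3 / 8 * K - δ * K / 2) * n := by ring
    rw [this, hδK, hK]; ring
  have hprod : (q : ℝ) / 2 * ((3 / 4 - δ) * q - 1 / 2) ≤ d * ((1 - δ) * q - d / 2) := by
    apply mul_le_mul
    · linarith
    · linarith
    · have : (3 / 8 : ℝ) * q ≤ (3 / 4 - δ) * q := by gcongr; linarith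
      linarith
    · positivity
  rw [hKval] at hmain
  have e1 : (q : ℝ) / 2 * ((3 / 4 - δ) * q - 1 / 2) = (3 / 8 - δ / 2) * (q : ℝ) ^ 2 - q / 4 := by
    ring
  have e2 : (d : ℝ) * ((1 - δ) * q - d / 2) = ((1 - δ) * q) * d - (d : ℝ) ^ 2 / 2 := by ring
  rw [e1, e2] at hprod
  linarith

noncomputable def mkM {n : ℕ} (q : ℕ) (h : List (Sym2 (Fin n))) : Finset (Sym2 (Fin n)) := by
  classical
  exact Finset.univ.filter (fun e => ∃ k, k % (q + 1) = 0 ∧ h[k]? = some e)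

noncomputable def mkB {n : ℕ} (q : ℕ) (h : List (Sym2 (Fin n))) : Finset (Sym2 (Fin n)) := by
  classical
  exact Finset.univ.filter (fun e => ∃ k, ¬ k % (q + 1) = 0 ∧ h[k]? = some e)

lemma mem_list_of {n : ℕ} (q : ℕ) (h : List (Sym2 (Fin n))) (e : Sym2 (Fin n)) :
    e ∈ h ↔ e ∈ mkM q h ∨ e ∈ mkB q h := by
  simp only [mkM, mkB, Finset.mem_filter, Finset.mem_univ, true_and]
  rw [List.mem_iff_getElem?]
  constructor
  · rintro ⟨k, hk⟩
    by_cases h0 : k % (q + 1) = 0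
    · exact Or.inl ⟨k, h0, hk⟩
    · exact Or.inr ⟨k, h0, hk⟩
  · rintro (⟨k, _, hk⟩ | ⟨k, _, hk⟩) <;> exact ⟨k, hk⟩

lemma mkM_range {n : ℕ} (q : ℕ) (e : ℕ → Sym2 (Fin n)) (k : ℕ) :
    mkM q ((List.range k).map e) = Ms q e k := by
  ext x
  simp only [mkM, Ms, Finset.mem_filter, Finset.mem_univ, true_and, Finset.mem_image,
    Finset.mem_range, List.getElem?_map, Option.map_eq_some_iff, List.getElem?_eq_some_iff,
    List.length_range, List.getElem_range]
  grind

lemma mkB_range {n : ℕ} (q : ℕ) (e : ℕ → Sym2 (Fin n)) (k : ℕ) :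
    mkB q ((List.range k).map e) = Bs q e k := by
  ext x
  simp only [mkB, Bs, Finset.mem_filter, Finset.mem_univ, true_and, Finset.mem_image,
    Finset.mem_range, List.getElem?_map, Option.map_eq_some_iff, List.getElem?_eq_some_iff,
    List.length_range, List.getElem_range]
  grind

lemma playHist_eq (n q : ℕ) (sM sB : Strategy n) (k : ℕ) :
    playHist n q sM sB k = (List.range k).map
      (fun k => (if k % (q + 1) = 0 then sM else sB) (playHist n q sM sB k)) := by
  induction k with
  | zero => rfl
  | succ k ih =>
    rw [List.range_succ, List.map_append, ← ih]
    rfl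

lemma exists_unclaimed (n : ℕ) (h : List (Sym2 (Fin n))) (hl : h.length < n.choose 2) :
    ∃ e : Sym2 (Fin n), IsEdge n e ∧ e ∉ h := by
  classical
  have hc : (Finset.univ.filter (fun e : Sym2 (Fin n) => ¬ e.IsDiag)).card = n.choose 2 := by
    have := Sym2.card_subtype_not_diag (α := Fin n)
    rw [Fintype.card_subtype, Fintype.card_fin] at this
    exact this
  obtain ⟨e, h1, h2⟩ := Finset.exists_mem_notMem_of_card_lt_card (s := h.toFinset)
    (t := Finset.univ.filter (fun e : Sym2 (Fin n) => ¬ e.IsDiag))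
    (by rw [hc]; exact (List.toFinset_card_le h).trans_lt hl)
  exact ⟨e, by simpa [IsEdge] using h1, by simpa using h2⟩

/-- For every real ε* > 0 there exists `N` such that for all
`n ≥ N`, Breaker has a winning strategy in the `(n,q)`-triangle game with
bias `q = ⌈√((8/3 + ε*)·n)⌉`. -/
theorem breaker_wins_triangle_game (εstar : ℝ) (hε : 0 < εstar) :
    ∃ N : ℕ, ∀ n : ℕ, N ≤ n →
      BreakerHasWinningStrategy n ⌈Real.sqrt ((8 / 3 + εstar) * n)⌉₊ := by
  classical
  obtain ⟨θ, δ, hθ, hθ2, hδ, hδ0, N, hN⟩ := params εstar hε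
  refine ⟨N, fun n hn => ?_⟩
  obtain ⟨hn1, hq1, hP⟩ := hN n hn _ rfl
  generalize ⌈Real.sqrt ((8 / 3 + εstar) * n)⌉₊ = q at *
  have hex : ∀ h : List (Sym2 (Fin n)), ∃ e : Sym2 (Fin n),
      (∃ e : Sym2 (Fin n), IsEdge n e ∧ e ∉ h) →
        Good ((1 - δ) * q) (θ / q) (mkM q h) (mkB q h) e := by
    intro h
    by_cases hh : ∃ e : Sym2 (Fin n), IsEdge n e ∧ e ∉ h
    · obtain ⟨e, he1, he2⟩ := hh
      rw [mem_list_of q] at he2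
      push Not at he2
      obtain ⟨e', he'⟩ := exists_good ((1 - δ) * q) (θ / q) (mkM q h) (mkB q h) ⟨e, he1, he2⟩
      exact ⟨e', fun _ => he'⟩
    · exact ⟨s(⟨0, hn1⟩, ⟨0, hn1⟩), fun h' => (hh h').elim⟩
  choose sB hsB using hex
  refine ⟨sB, ?_, ?_⟩
  · intro h hh
    have := hsB h hh
    refine ⟨this.1, ?_⟩
    rw [mem_list_of q]
    exact not_or.2 ⟨this.2.1, this.2.2.1⟩
  · intro sM hM
    set e : ℕ → Sym2 (Fin n) :=
      fun k => (if k % (q + 1) = 0 then sM else sB) (playHist n q sM sB k) with he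
    have hplay : ∀ k, playHist n q sM sB k = (List.range k).map e := playHist_eq n q sM sB
    have hun : ∀ k < n.choose 2, ∃ e : Sym2 (Fin n), IsEdge n e ∧ e ∉ playHist n q sM sB k := by
      intro k hk
      apply exists_unclaimed
      rw [hplay]; simpa using hk
    have hgood : ∀ k < n.choose 2, ¬ k % (q + 1) = 0 →
        Good ((1 - δ) * q) (θ / q) (Ms q e k) (Bs q e k) (e k) := by
      intro k hk h0
      have := hsB _ (hun k hk)
      have h2 : e k = sB (playHist n q sM sB k) := congrFun (if_neg h0) _
      rw [← h2, hplay, mkM_range, mkB_range] at this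
      exact this
    have hedge : ∀ k < n.choose 2, ¬ (e k).IsDiag ∧ e k ∉ Ms q e k ∧ e k ∉ Bs q e k := by
      intro k hk
      by_cases h0 : k % (q + 1) = 0
      · have := hM _ (hun k hk)
        have h2 : e k = sM (playHist n q sM sB k) := congrFun (if_pos h0) _
        rw [← h2, mem_list_of q, hplay, mkM_range, mkB_range, not_or] at this
        exact this
      · have := hgood k hk h0
        exact ⟨this.1, this.2.1, this.2.2.1⟩
    have hown : ∀ x, MakerOwns n q sM sB x → x ∈ Ms q e (n.choose 2) := by
      rintro x ⟨k, hk, h0, hx⟩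
      rw [← mkM_range, ← hplay]
      simp only [mkM, Finset.mem_filter, Finset.mem_univ, true_and]
      exact ⟨k, h0, hx⟩
    rintro ⟨x, y, z, hxy, hyz, hxz, h1, h2, h3⟩
    exact final_no_tri q ((1 - δ) * q) (θ / q) θ δ hθ hθ2 hδ hδ0 hq1 rfl rfl hP e _ hedge hgood
      x y z hxy hyz hxz (hown _ h1) (hown _ h2) (hown _ h3)
end

section
/- Let n > 0 and β > 8/3 be real numbers, let δ ∈ (0, 1 − 8/(3β)), set q := √(β·n) and p₀ := 8/(β(1−δ)(3+δ)). Assume q ≥ 2 and δ²·q/8 ≥ 3/4. Then for every real m with q/2 − 1 ≤ m ≤ q/2, one has n − p₀·(q²(1−δ)(3+δ)/8 − m·(q − m/2)) ≥ n + 2δn/3. -/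
/-- For reals n > 0, β > 8/3, δ ∈ (0, 1 − 8/(3β)), with
q := √(βn) and p₀ := 8/(β(1−δ)(3+δ)), assuming q ≥ 2 and δ²q/8 ≥ 3/4,
for every real m with q/2 − 1 ≤ m ≤ q/2 one has
n − p₀·(q²(1−δ)(3+δ)/8 − m·(q − m/2)) ≥ n + 2δn/3. -/
theorem balanced_degree_lower_bound (n β δ : ℝ) (hn : 0 < n) (hβ : 8 / 3 < β)
    (hδ0 : 0 < δ) (hδ1 : δ < 1 - 8 / (3 * β)) :
    let q := Real.sqrt (β * n)
    let p₀ := 8 / (β * (1 - δ) * (3 + δ))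
    2 ≤ q → 3 / 4 ≤ δ ^ 2 * q / 8 →
    ∀ m : ℝ, q / 2 - 1 ≤ m → m ≤ q / 2 →
      n - p₀ * (q ^ 2 * (1 - δ) * (3 + δ) / 8 - m * (q - m / 2))
        ≥ n + 2 * δ * n / 3 := by
  intro q p₀ hq h m hm1 hm2
  have hβ0 : 0 < β := by linarith
  have hq2 : q ^ 2 = β * n := Real.sq_sqrt (by positivity)
  have h1 : 0 < 1 - δ := by
    have : 0 < 8 / (3 * β) := by positivity
    linarith
  have hD : 0 < (1 - δ) * (3 + δ) := by positivity
  have hD3 : (1 - δ) * (3 + δ) ≤ 3 := by nlinarith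
  have hp : 0 < p₀ := by
    change 0 < 8 / (β * (1 - δ) * (3 + δ))
    positivity
  have ha : 3 * q ^ 2 / 8 - q / 2 - 1 / 2 ≤ m * (q - m / 2) := by
    nlinarith [mul_nonneg (sub_nonneg.2 hm1) (by linarith : 0 ≤ 2 * q - (m + (q / 2 - 1)))]
  have hb : 3 / 4 * q ≤ δ ^ 2 * q / 8 * q := mul_le_mul_of_nonneg_right h (by linarith)
  have hc : q ^ 2 * δ / 4 ≤ m * (q - m / 2) - q ^ 2 * (1 - δ) * (3 + δ) / 8 := by
    nlinarith
  have hd := mul_le_mul_of_nonneg_left hc hp.le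
  have he : 2 * δ * n / 3 ≤ p₀ * (q ^ 2 * δ / 4) := by
    have : p₀ * (q ^ 2 * δ / 4) = 2 * δ * n / ((1 - δ) * (3 + δ)) := by
      rw [hq2]
      change 8 / (β * (1 - δ) * (3 + δ)) * _ = _
      have h3 : 3 + δ ≠ 0 := by positivity
      field_simp
      ring
    rw [this]
    exact div_le_div_of_nonneg_left (by positivity) hD hD3
  nlinarith
end

section
/- Fix real numbers β with 8/3 < β ≤ 4 and δ ∈ (0, 1 − 8/(3β)). For a natural number n set q := √(β·n), p₀ := 8/(β(1−δ)(3+δ)), μ := 1 + 6β·ln(n)/(δ·q), m := ⌈q/2⌉ − 1, and for a real number d_B define deg* := n − p₀·(q²(1−δ)(3+δ)/8 − m·(q − m/2)) and d := deg* − d_B. Then there exists N such that for all n ≥ N and all real d_B with 0 ≤ d_B ≤ n, one has μ^{d/q} > 2n. -/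
/-- For fixed reals β ∈ (8/3, 4] and δ ∈ (0, 1 − 8/(3β)),
with q := √(βn), p₀ := 8/(β(1−δ)(3+δ)), μ := 1 + 6β·ln(n)/(δq),
m := ⌈q/2⌉ − 1, deg* := n − p₀·(q²(1−δ)(3+δ)/8 − m·(q − m/2)) and
d := deg* − d_B, there exists N such that for all natural n ≥ N and all
real d_B with 0 ≤ d_B ≤ n one has μ^{d/q} > 2n. -/
theorem potential_at_half_star (β δ : ℝ) (hβl : 8 / 3 < β) (hβu : β ≤ 4)
    (hδ0 : 0 < δ) (hδ1 : δ < 1 - 8 / (3 * β)) :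
    ∃ N : ℕ, ∀ n : ℕ, N ≤ n → ∀ d_B : ℝ, 0 ≤ d_B → d_B ≤ n →
      let q : ℝ := Real.sqrt (β * n)
      let p₀ : ℝ := 8 / (β * (1 - δ) * (3 + δ))
      let μ : ℝ := 1 + 6 * β * Real.log n / (δ * q)
      let m : ℝ := (⌈q / 2⌉₊ : ℝ) - 1
      let degstar : ℝ := n - p₀ * (q ^ 2 * (1 - δ) * (3 + δ) / 8 - m * (q - m / 2))
      let d : ℝ := degstar - d_B
      μ ^ (d / q) > 2 * n := by
  have hβ : 0 < β := by linarith
  have hδ2 : 0 < 1 - δ := by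
    have : 0 < 8 / (3 * β) := by positivity
    linarith
  have hq : Filter.Tendsto (fun n : ℕ => Real.sqrt (β * n)) Filter.atTop Filter.atTop :=
    Real.tendsto_sqrt_atTop.comp
      ((tendsto_natCast_atTop_atTop (R := ℝ)).const_mul_atTop hβ)
  have hlog : ∀ᶠ n : ℕ in Filter.atTop,
      Real.log (n : ℝ) ≤ (δ / (6 * β) * Real.sqrt β) * Real.sqrt n := by
    have h := (isLittleO_log_rpow_atTop (r := 1 / 2) (by norm_num)).comp_tendsto
      (tendsto_natCast_atTop_atTop (R := ℝ))
    have h2 := h.def (c := δ / (6 * β) * Real.sqrt β) (by positivity)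
    filter_upwards [h2] with n hn
    simp only [Function.comp, ← Real.sqrt_eq_rpow, Real.norm_eq_abs] at hn
    rw [abs_of_nonneg (Real.sqrt_nonneg (n : ℝ))] at hn
    exact (le_abs_self _).trans hn
  have hev := (hlog.and (hq.eventually_ge_atTop
    (8 / (β * (1 - δ) * (3 + δ)) * (6 * β / δ)))).and
    ((hq.eventually_ge_atTop 2).and (Filter.eventually_ge_atTop (5 : ℕ)))
  obtain ⟨N, hN⟩ := Filter.eventually_atTop.1 hev
  refine ⟨N, fun n hn d_B h0 h1 => ?_⟩
  obtain ⟨⟨hL, hC⟩, hq2, hn5⟩ := hN n hn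
  intro q p₀ μ m degstar d
  have hn5' : (5 : ℝ) ≤ n := by exact_mod_cast hn5
  have hq2 : 2 ≤ q := hq2
  have hqpos : 0 < q := by linarith
  have hqq : q ^ 2 = β * n := Real.sq_sqrt (by positivity)
  have hp : 0 < p₀ := by positivity
  have hpe : p₀ * ((1 - δ) * (3 + δ)) * β = 8 := by
    simp only [p₀]; field_simp
  have hC : p₀ * (6 * β / δ) ≤ q := hC
  have hLq : Real.log n ≤ δ / (6 * β) * q := by
    refine hL.trans (le_of_eq ?_)
    simp only [q]; rw [Real.sqrt_mul hβ.le]; ring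
  have hm1 : q / 2 - 1 ≤ m := by
    have := Nat.le_ceil (q / 2)
    simp only [m]; linarith
  have hm2 : m ≤ q / 2 := by
    have := Nat.ceil_lt_add_one (a := q / 2) (by positivity)
    simp only [m]; linarith
  have hf : 3 * q ^ 2 / 8 - q / 2 - 1 / 2 ≤ m * (q - m / 2) := by
    nlinarith [mul_nonneg (sub_nonneg.2 hm1) (sub_nonneg.2 hm2)]
  have hdeg : degstar = p₀ * (m * (q - m / 2)) := by
    have : p₀ * (q ^ 2 * (1 - δ) * (3 + δ) / 8) = n := by
      rw [hqq]; linear_combination (n : ℝ) / 8 * hpe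
    simp only [degstar]; linear_combination -this
  have hd1 : p₀ * (3 * q ^ 2 / 8 - q) - n ≤ d := by
    have : p₀ * (3 * q ^ 2 / 8 - q) ≤ p₀ * (m * (q - m / 2)) :=
      mul_le_mul_of_nonneg_left (by linarith) hp.le
    simp only [d]; rw [hdeg]; linarith
  have hn_eq : (n : ℝ) = q ^ 2 / β := by rw [hqq]; field_simp
  have hpl : (3 + 2 * δ) / β ≤ p₀ * 3 * 3 / 8 := by
    simp only [p₀]
    rw [div_mul_eq_mul_div, div_mul_eq_mul_div, div_div, div_le_div_iff₀ hβ (by positivity)]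
    have : (3 + 2 * δ) * ((1 - δ) * (3 + δ)) ≤ 9 := by
      nlinarith [mul_pos hδ0 hδ0, mul_pos hδ0 (mul_pos hδ0 hδ0)]
    nlinarith [mul_le_mul_of_nonneg_left this hβ.le]
  have hpq : p₀ ≤ δ / (6 * β) * q := by
    have := mul_le_mul_of_nonneg_left hC (show 0 ≤ δ / (6 * β) by positivity)
    have e : δ / (6 * β) * (p₀ * (6 * β / δ)) = p₀ := by field_simp
    linarith
  have hd : δ / (2 * β) * q ≤ d / q := by
    rw [le_div_iff₀ hqpos]
    have a1 := mul_le_mul_of_nonneg_right hpl (show 0 ≤ q ^ 2 / 3 by positivity)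
    have a2 := mul_le_mul_of_nonneg_right hpq hqpos.le
    have e : (3 + 2 * δ) / β * (q ^ 2 / 3) - q ^ 2 / β - δ / (6 * β) * q * q
        = δ / (2 * β) * q * q := by field_simp; ring
    rw [hn_eq] at hd1
    linarith
  have hLpos : 0 < Real.log n := Real.log_pos (by linarith)
  set x : ℝ := 6 * β * Real.log n / (δ * q) with hx
  have hx0 : 0 < x := by positivity
  have hx1 : x ≤ 1 := by
    rw [hx, div_le_one (by positivity)]
    have := mul_le_mul_of_nonneg_left hLq (show 0 ≤ 6 * β by positivity)
    have e : 6 * β * (δ / (6 * β) * q) = δ * q := by field_simp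
    linarith
  have hlogμ : x / 2 ≤ Real.log μ := by
    have h := Real.le_log_one_add_of_nonneg hx0.le
    refine le_trans ?_ h
    rw [div_le_div_iff₀ (by norm_num) (by linarith)]
    nlinarith
  have hμ : 0 < μ := by simp only [μ]; linarith
  have hmain : 3 / 2 * Real.log n ≤ Real.log μ * (d / q) := by
    have e : x / 2 * (δ / (2 * β) * q) = 3 / 2 * Real.log n := by
      rw [hx]; field_simp; ring
    rw [← e]
    exact mul_le_mul hlogμ hd (by positivity) (by linarith)
  have h4 : 2 * Real.log 2 < Real.log n := by
    have : Real.log ((2 : ℝ) ^ 2) < Real.log n :=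
      Real.log_lt_log (by norm_num) (by linarith)
    rw [Real.log_pow] at this
    exact_mod_cast this
  have h5 : Real.log (2 * n) < Real.log μ * (d / q) := by
    rw [Real.log_mul (by norm_num) (by linarith)]
    linarith
  rw [gt_iff_lt, Real.rpow_def_of_pos hμ]
  exact (Real.log_lt_iff_lt_exp (by linarith)).1 h5
end
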